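/- Let g : ℝ → [0,∞) be a probability density function such that ∫_ℝ g(y)^{1+δ} dy < ∞ for some δ > 0 and ∫_ℝ |y|^ε g(y) dy < ∞ for some ε > 0. Suppose g(y) = ∑_i g_i(y) is a countable sum of nonnegative measurable functions g_i, and set p_i = ∫_ℝ g_i(y) dy. If −∑_i p_i log p_i < ∞, then ∑_i |∫_ℝ g_i(y) log g_i(y) dy| < ∞. -/

import Mathlib

open MeasureTheory

/-- Combines `log t ≤ log b ≤ b ^ δ / δ` with the Gibbs inequality `-t * log t ≤ -t * log a + a`
for `a = q * h`. -/
theorem abs_mul_log_le {t b δ q h : ℝ} (ht : 0 ≤ t) (htb : t ≤ b) (hδ : 0 < δ)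
    (hq : 0 < q) (hq1 : q ≤ 1) (hh : 0 < h) (hh1 : h ≤ 1) :
    |t * Real.log t| ≤ t * (b ^ δ / δ) + t * -Real.log h + t * -Real.log q + q * h := by
  have hlq : 0 ≤ -Real.log q := neg_nonneg.2 (Real.log_nonpos hq.le hq1)
  have hlh : 0 ≤ -Real.log h := neg_nonneg.2 (Real.log_nonpos hh.le hh1)
  have hb : 0 ≤ b ^ δ / δ := div_nonneg (Real.rpow_nonneg (ht.trans htb) _) hδ.le
  have h₁ := mul_nonneg ht hlq
  have h₂ := mul_nonneg ht hlh
  have h₃ := mul_nonneg ht hb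
  have h₄ := mul_pos hq hh
  rcases ht.eq_or_lt with rfl | ht'
  · simpa using h₄.le
  refine abs_le'.2 ⟨?_, ?_⟩
  · have hlog : Real.log t ≤ b ^ δ / δ :=
      (Real.log_le_log ht' htb).trans (Real.log_le_rpow_div (ht.trans htb) hδ)
    have := mul_le_mul_of_nonneg_left hlog ht
    linarith
  · have hlog := Real.log_le_sub_one_of_pos (div_pos h₄ ht')
    rw [Real.log_div h₄.ne' ht'.ne', Real.log_mul hq.ne' hh.ne'] at hlog
    have := mul_le_mul_of_nonneg_left hlog ht
    have hcancel : t * (q * h / t - 1) = q * h - t := by field_simp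
    rw [hcancel] at this
    linarith

theorem log_one_add_sq_le {ε : ℝ} (hε : 0 < ε) (y : ℝ) :
    Real.log (1 + y ^ 2) ≤ 2 * 2 ^ ε / ε * (1 + |y| ^ ε) := by
  have hy := abs_nonneg y
  have hle : Real.log (1 + y ^ 2) ≤ 2 * Real.log (1 + |y|) := by
    have hpow : Real.log ((1 + |y|) ^ 2) = 2 * Real.log (1 + |y|) := by
      rw [Real.log_pow]; norm_num
    rw [← hpow]
    refine Real.log_le_log (by positivity) ?_
    rw [← sq_abs y]
    nlinarith
  have hpow : (1 + |y|) ^ ε ≤ 2 ^ ε * (1 + |y| ^ ε) := by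
    have hmax : (1 + |y|) ^ ε ≤ (2 * max 1 |y|) ^ ε := by
      refine Real.rpow_le_rpow (by positivity) ?_ hε.le
      linarith [le_max_left 1 |y|, le_max_right 1 |y|]
    refine hmax.trans ?_
    rw [Real.mul_rpow (by norm_num) (by positivity)]
    refine mul_le_mul_of_nonneg_left ?_ (by positivity)
    have := Real.rpow_nonneg hy ε
    rcases max_choice 1 |y| with h | h <;> rw [h]
    · rw [Real.one_rpow]; linarith
    · linarith
  calc Real.log (1 + y ^ 2) ≤ 2 * ((1 + |y|) ^ ε / ε) :=
        hle.trans (by gcongr; exact Real.log_le_rpow_div (by positivity) hε)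
    _ ≤ 2 * (2 ^ ε * (1 + |y| ^ ε) / ε) := by gcongr
    _ = _ := by ring

/-- If the density `G` has a finite moment of order `ε` and a finite `1 + δ` power, then
`G` is integrable against the weight `G ^ δ / δ + log (1 + y ^ 2)`. -/
theorem lintegral_mul_weight_lt_top {G : ℝ → ℝ} {δ ε : ℝ} (hGmeas : Measurable G)
    (hGnonneg : ∀ y, 0 ≤ G y) (hδ : 0 < δ) (hε : 0 < ε)
    (hG : ∫⁻ y, ENNReal.ofReal (G y) < ⊤)
    (hb : ∫⁻ y, ENNReal.ofReal (G y ^ (1 + δ)) < ⊤)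
    (ha : ∫⁻ y, ENNReal.ofReal (|y| ^ ε * G y) < ⊤) :
    ∫⁻ y, ENNReal.ofReal (G y * (G y ^ δ / δ + Real.log (1 + y ^ 2))) < ⊤ := by
  have hK : 0 ≤ 2 * 2 ^ ε / ε := by positivity
  have hle : ∀ y, ENNReal.ofReal (G y * (G y ^ δ / δ + Real.log (1 + y ^ 2))) ≤
      ENNReal.ofReal δ⁻¹ * ENNReal.ofReal (G y ^ (1 + δ)) +
        ENNReal.ofReal (2 * 2 ^ ε / ε) *
          (ENNReal.ofReal (G y) + ENNReal.ofReal (|y| ^ ε * G y)) := by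
    intro y
    have hGy := hGnonneg y
    have h₁ : 0 ≤ |y| ^ ε * G y := by positivity
    have h₂ : 0 ≤ G y ^ (1 + δ) := by positivity
    rw [← ENNReal.ofReal_add hGy h₁, ← ENNReal.ofReal_mul hK,
      ← ENNReal.ofReal_mul (by positivity), ← ENNReal.ofReal_add (by positivity) (by positivity)]
    refine ENNReal.ofReal_le_ofReal ?_
    rw [Real.rpow_add_of_nonneg hGy zero_le_one hδ.le, Real.rpow_one]
    have := mul_le_mul_of_nonneg_left (log_one_add_sq_le hε y) hGy
    calc G y * (G y ^ δ / δ + Real.log (1 + y ^ 2))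
        = δ⁻¹ * (G y * G y ^ δ) + G y * Real.log (1 + y ^ 2) := by ring
      _ ≤ δ⁻¹ * (G y * G y ^ δ) + G y * (2 * 2 ^ ε / ε * (1 + |y| ^ ε)) := by gcongr
      _ = _ := by ring
  refine (lintegral_mono hle).trans_lt ?_
  rw [lintegral_add_left (by fun_prop), lintegral_const_mul _ (by fun_prop),
    lintegral_const_mul _ (by fun_prop), lintegral_add_left (by fun_prop)]
  exact ENNReal.add_lt_top.2 ⟨ENNReal.mul_lt_top ENNReal.ofReal_lt_top hb,
    ENNReal.mul_lt_top ENNReal.ofReal_lt_top (ENNReal.add_lt_top.2 ⟨hG, ha⟩)⟩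

theorem tsum_lintegral_ofReal_mul {α : Type*} [MeasurableSpace α] {μ : Measure α}
    {g : ℕ → α → ℝ} {G w : α → ℝ} (hmeas : ∀ i, Measurable (g i))
    (hnonneg : ∀ i y, 0 ≤ g i y) (hG : ∀ y, HasSum (fun i => g i y) (G y))
    (hw : Measurable w) (hw0 : ∀ y, 0 ≤ w y) :
    ∑' i, ∫⁻ y, ENNReal.ofReal (g i y * w y) ∂μ = ∫⁻ y, ENNReal.ofReal (G y * w y) ∂μ := by
  rw [← lintegral_tsum fun i => by fun_prop]
  refine lintegral_congr fun y => ?_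
  have hs := (hG y).mul_right (w y)
  rw [← ENNReal.ofReal_tsum_of_nonneg (fun i => mul_nonneg (hnonneg i y) (hw0 y)) hs.summable,
    hs.tsum_eq]

/-- Bound for the absolute entropy of a nonnegative function of mass `p` dominated by `G`. -/
theorem lintegral_enorm_mul_log_le {f G : ℝ → ℝ} {p δ : ℝ} (hf : Measurable f)
    (hf0 : ∀ y, 0 ≤ f y) (hG : Measurable G) (hfG : ∀ y, f y ≤ G y) (hδ : 0 < δ)
    (hp : ∫⁻ y, ENNReal.ofReal (f y) = ENNReal.ofReal p) (hp1 : p ≤ 1) :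
    ∫⁻ y, ‖f y * Real.log (f y)‖ₑ ≤
      (∫⁻ y, ENNReal.ofReal (f y * (G y ^ δ / δ + Real.log (1 + y ^ 2)))) +
        ENNReal.ofReal (-(p * Real.log p)) +
        ENNReal.ofReal p * ∫⁻ y : ℝ, ENNReal.ofReal (1 + y ^ 2)⁻¹ := by
  rcases le_or_gt p 0 with hp0 | hp0
  · rw [ENNReal.ofReal_of_nonpos hp0, lintegral_eq_zero_iff (by fun_prop)] at hp
    have hzero : ∫⁻ y, ‖f y * Real.log (f y)‖ₑ = 0 := by
      rw [lintegral_eq_zero_iff (by fun_prop)]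
      filter_upwards [hp] with y hy
      have : f y = 0 := le_antisymm (ENNReal.ofReal_eq_zero.1 hy) (hf0 y)
      simp [this]
    rw [hzero]
    exact zero_le
  have hlp : 0 ≤ -Real.log p := neg_nonneg.2 (Real.log_nonpos hp0.le hp1)
  have hle : ∀ y, ‖f y * Real.log (f y)‖ₑ ≤
      ENNReal.ofReal (f y * (G y ^ δ / δ + Real.log (1 + y ^ 2))) +
        ENNReal.ofReal (f y) * ENNReal.ofReal (-Real.log p) +
        ENNReal.ofReal p * ENNReal.ofReal (1 + y ^ 2)⁻¹ := by
    intro y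
    have hy : (1 : ℝ) ≤ 1 + y ^ 2 := by nlinarith [sq_nonneg y]
    have hw : 0 ≤ G y ^ δ / δ + Real.log (1 + y ^ 2) :=
      add_nonneg (div_nonneg (Real.rpow_nonneg ((hf0 y).trans (hfG y)) _) hδ.le)
        (Real.log_nonneg hy)
    have h₁ := mul_nonneg (hf0 y) hw
    have h₂ := mul_nonneg (hf0 y) hlp
    rw [← ENNReal.ofReal_mul (hf0 y), ← ENNReal.ofReal_mul hp0.le, ← ENNReal.ofReal_add h₁ h₂,
      ← ENNReal.ofReal_add (add_nonneg h₁ h₂) (by positivity), Real.enorm_eq_ofReal_abs]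
    refine ENNReal.ofReal_le_ofReal ?_
    have := abs_mul_log_le (hf0 y) (hfG y) hδ hp0 hp1 (inv_pos.2 (zero_lt_one.trans_le hy))
      (inv_le_one_of_one_le₀ hy)
    rw [Real.log_inv, neg_neg] at this
    linarith
  refine (lintegral_mono hle).trans_eq ?_
  rw [lintegral_add_left (by fun_prop), lintegral_add_left (by fun_prop),
    lintegral_mul_const _ (by fun_prop), lintegral_const_mul _ (by fun_prop), hp,
    ← ENNReal.ofReal_mul hp0.le, mul_neg]

/- STATEMENT 3: If g is a probability density on ℝ with ∫ g^{1+δ} < ∞ for some δ > 0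
and a finite ε-th moment for some ε > 0, and g = ∑ᵢ gᵢ is a countable sum of
nonnegative measurable functions with pᵢ = ∫ gᵢ satisfying −∑ᵢ pᵢ log pᵢ < ∞, then
each ∫ gᵢ log gᵢ is well defined and ∑ᵢ |∫ gᵢ(y) log gᵢ(y) dy| < ∞. -/
theorem sum_abs_integral_log_lt_top
    (g : ℕ → ℝ → ℝ) (G : ℝ → ℝ) (p : ℕ → ℝ)
    (hmeas : ∀ i, Measurable (g i))
    (hnonneg : ∀ i y, 0 ≤ g i y)
    (hGmeas : Measurable G)
    (hGnonneg : ∀ y, 0 ≤ G y)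
    (hpdf : ∫ y, G y = 1)
    (hG : ∀ y, HasSum (fun i => g i y) (G y))
    (hp : ∀ i, ∫⁻ y, ENNReal.ofReal (g i y) = ENNReal.ofReal (p i))
    (hb : ∃ δ > (0 : ℝ), ∫⁻ y, ENNReal.ofReal (G y ^ (1 + δ)) < ⊤)
    (ha : ∃ ε > (0 : ℝ), ∫⁻ y, ENNReal.ofReal (|y| ^ ε * G y) < ⊤)
    (hc : ∑' i, ENNReal.ofReal (-(p i * Real.log (p i))) < ⊤) :
    (∀ i, MeasureTheory.Integrable (fun y => g i y * Real.log (g i y))) ∧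
      Summable (fun i => |∫ y, g i y * Real.log (g i y)|) := by
  obtain ⟨δ, hδ, hb⟩ := hb
  obtain ⟨ε, hε, ha⟩ := ha
  have hGint : Integrable G := by
    by_contra h
    simp [integral_undef h] at hpdf
  have hG1 : ∫⁻ y, ENNReal.ofReal (G y) = 1 := by
    rw [← ofReal_integral_eq_lintegral_ofReal hGint (ae_of_all _ hGnonneg), hpdf,
      ENNReal.ofReal_one]
  have hgG : ∀ i y, g i y ≤ G y := fun i y => le_hasSum (hG y) i fun j _ => hnonneg j y
  have hp1 : ∀ i, p i ≤ 1 := fun i => by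
    rw [← ENNReal.ofReal_le_one, ← hp i, ← hG1]
    exact lintegral_mono fun y => ENNReal.ofReal_le_ofReal (hgG i y)
  have hpsum : ∑' i, ENNReal.ofReal (p i) = 1 := by
    have := tsum_lintegral_ofReal_mul (μ := volume) hmeas hnonneg hG
      (measurable_const (a := (1 : ℝ))) fun _ => zero_le_one
    simpa only [mul_one, hp, hG1] using this
  have hw : ∀ y, 0 ≤ G y ^ δ / δ + Real.log (1 + y ^ 2) := fun y =>
    add_nonneg (div_nonneg (Real.rpow_nonneg (hGnonneg y) _) hδ.le)
      (Real.log_nonneg (by nlinarith [sq_nonneg y]))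
  have hcauchy : ∫⁻ y : ℝ, ENNReal.ofReal (1 + y ^ 2)⁻¹ < ⊤ :=
    integrable_inv_one_add_sq.lintegral_lt_top
  have hfin : ∑' i, ∫⁻ y, ‖g i y * Real.log (g i y)‖ₑ < ⊤ := by
    refine (ENNReal.tsum_le_tsum fun i => lintegral_enorm_mul_log_le (hmeas i) (hnonneg i) hGmeas
      (hgG i) hδ (hp i) (hp1 i)).trans_lt ?_
    rw [ENNReal.tsum_add, ENNReal.tsum_add, ENNReal.tsum_mul_right, hpsum, one_mul,
      tsum_lintegral_ofReal_mul hmeas hnonneg hG (by fun_prop) hw]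
    exact ENNReal.add_lt_top.2 ⟨ENNReal.add_lt_top.2 ⟨lintegral_mul_weight_lt_top hGmeas hGnonneg
      hδ hε (hG1 ▸ ENNReal.one_lt_top) hb ha, hc⟩, hcauchy⟩
  refine ⟨fun i => ⟨by fun_prop, (ENNReal.le_tsum i).trans_lt hfin⟩, ?_⟩
  refine (ENNReal.summable_toReal hfin.ne).of_nonneg_of_le (fun _ => abs_nonneg _) fun i => ?_
  rw [← Real.norm_eq_abs, ← toReal_enorm]
  exact ENNReal.toReal_mono (ENNReal.ne_top_of_tsum_ne_top hfin.ne i)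
    (enorm_integral_le_lintegral_enorm _)
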